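/- arXiv:2107.04336 — 2 statements merged into one kernel-verified Lean document; each statement's English description precedes it below -/
import Mathlib

section
/- Let n ≥ 1 be an integer and let 1 < p < ∞. Define V_p : ℝⁿ → ℝⁿ by V_p(ξ) = (1+|ξ|²)^((p−2)/4) ξ. Then there exists a constant C > 0, depending only on n and p, such that for all ξ, η ∈ ℝⁿ with ξ ≠ η one has C⁻¹ (1+|ξ|²+|η|²)^((p−2)/2) ≤ |V_p(ξ) − V_p(η)|² / |ξ − η|² ≤ C (1+|ξ|²+|η|²)^((p−2)/2). -/
open Real

/-- The auxiliary function `V_p(ξ) = (1+|ξ|²)^((p−2)/4) ξ`. -/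
noncomputable def Vp (n : ℕ) (p : ℝ) (ξ : EuclideanSpace ℝ (Fin n)) :
    EuclideanSpace ℝ (Fin n) :=
  ((1 + ‖ξ‖ ^ 2) ^ ((p - 2) / 4)) • ξ

/-- The oscillation of the weight `(1 + t²)^q`, damped by the smaller argument, is controlled by
the weight at the larger argument. -/
theorem abs_weight_sub_mul_le {q a b : ℝ} (hq : -(1 / 2) ≤ q) (hb : 0 ≤ b) (hab : b ≤ a) :
    |(1 + a ^ 2) ^ q - (1 + b ^ 2) ^ q| * b ≤ 2 * |q| * (1 + a ^ 2) ^ q * (a - b) := by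
  have hA : 0 < (1 + a ^ 2) ^ q := by positivity
  rcases hb.eq_or_lt with rfl | hb
  · simp only [mul_zero, sub_zero]
    positivity
  have ha : 0 < a := hb.trans_le hab
  obtain ⟨y, hy, rfl⟩ : ∃ y, 0 < y ∧ b = y * a := ⟨b / a, by positivity, by field_simp⟩
  have hy1 : y ≤ 1 := by nlinarith
  have hbase : (1 + a ^ 2) * y ^ 2 ≤ 1 + (y * a) ^ 2 := by nlinarith
  have hpow : ((1 + a ^ 2) * y ^ 2) ^ q * y = (1 + a ^ 2) ^ q * y ^ (2 * q + 1) := by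
    rw [mul_rpow (by positivity) (by positivity), ← rpow_natCast_mul hy.le, mul_assoc,
      rpow_add_one hy.ne', Nat.cast_ofNat]
  have hmono : (y * a) ^ 2 ≤ a ^ 2 := by gcongr
  set A := (1 + a ^ 2) ^ q
  set B := (1 + (y * a) ^ 2) ^ q
  suffices h : |A - B| * y ≤ 2 * |q| * A * (1 - y) by
    nlinarith [mul_le_mul_of_nonneg_right h ha.le]
  rcases le_total 0 q with h0 | h0
  · have hBA : B ≤ A := by simp only [A, B]; gcongr
    have hAB : ((1 + a ^ 2) * y ^ 2) ^ q ≤ B := by simp only [B]; gcongr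
    have hbern := one_add_mul_self_le_rpow_one_add (s := y - 1) (by linarith)
      (p := 2 * q + 1) (by linarith)
    rw [add_sub_cancel] at hbern
    rw [abs_of_nonneg h0, abs_of_nonneg (sub_nonneg.2 hBA)]
    nlinarith [mul_le_mul_of_nonneg_right hAB hy.le, mul_le_mul_of_nonneg_left hbern hA.le]
  · have hBA : A ≤ B := rpow_le_rpow_of_nonpos (by positivity) (by linarith) h0
    have hAB : B ≤ ((1 + a ^ 2) * y ^ 2) ^ q :=
      rpow_le_rpow_of_nonpos (by positivity) hbase h0
    have hbern := rpow_one_add_le_one_add_mul_self (s := y - 1) (by linarith)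
      (p := 2 * q + 1) (by linarith) (by linarith)
    rw [add_sub_cancel] at hbern
    rw [abs_of_nonpos h0, abs_of_nonpos (sub_nonpos.2 hBA)]
    nlinarith [mul_le_mul_of_nonneg_right hAB hy.le, mul_le_mul_of_nonneg_left hbern hA.le]

section InnerProductSpace

variable {E : Type*} [NormedAddCommGroup E] [InnerProductSpace ℝ E]

theorem norm_weight_sub_smul_le {q : ℝ} (hq : -(1 / 2) ≤ q) {x y : E} (hyx : ‖y‖ ≤ ‖x‖) :
    ‖((1 + ‖x‖ ^ 2) ^ q - (1 + ‖y‖ ^ 2) ^ q) • y‖ ≤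
      2 * |q| * (1 + ‖x‖ ^ 2) ^ q * ‖x - y‖ := by
  rw [norm_smul, norm_eq_abs]
  refine (abs_weight_sub_mul_le hq (norm_nonneg y) hyx).trans ?_
  gcongr
  exact norm_sub_norm_le x y

theorem norm_weight_smul_sub_le {q : ℝ} (hq : -(1 / 2) ≤ q) {x y : E} (hyx : ‖y‖ ≤ ‖x‖) :
    ‖(1 + ‖x‖ ^ 2) ^ q • x - (1 + ‖y‖ ^ 2) ^ q • y‖ ≤
      (1 + 2 * |q|) * (1 + ‖x‖ ^ 2) ^ q * ‖x - y‖ := by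
  have h := norm_weight_sub_smul_le hq hyx
  have hA : 0 < (1 + ‖x‖ ^ 2) ^ q := by positivity
  set A := (1 + ‖x‖ ^ 2) ^ q
  set B := (1 + ‖y‖ ^ 2) ^ q
  calc ‖A • x - B • y‖ = ‖A • (x - y) + (A - B) • y‖ := by congr 1; module
    _ ≤ ‖A • (x - y)‖ + ‖(A - B) • y‖ := norm_add_le _ _
    _ ≤ A * ‖x - y‖ + 2 * |q| * A * ‖x - y‖ := by
      rw [norm_smul, norm_of_nonneg hA.le]
      gcongr
    _ = (1 + 2 * |q|) * A * ‖x - y‖ := by ring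

theorem weight_mul_norm_sub_le {q : ℝ} (hq : -(1 / 4) ≤ q) {x y : E} (hyx : ‖y‖ ≤ ‖x‖) :
    (1 + ‖x‖ ^ 2) ^ q * ‖x - y‖ ≤
      2 * ‖(1 + ‖x‖ ^ 2) ^ q • x - (1 + ‖y‖ ^ 2) ^ q • y‖ := by
  have h := norm_weight_sub_smul_le (by linarith : -(1 / 2) ≤ q) hyx
  have hA : 0 < (1 + ‖x‖ ^ 2) ^ q := by positivity
  have hB : 0 < (1 + ‖y‖ ^ 2) ^ q := by positivity
  have hsq : ‖y‖ ^ 2 ≤ ‖x‖ ^ 2 := by gcongr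
  rcases le_total 0 q with h0 | h0
  · have hBA : (1 + ‖y‖ ^ 2) ^ q ≤ (1 + ‖x‖ ^ 2) ^ q := by gcongr
    set A := (1 + ‖x‖ ^ 2) ^ q
    set B := (1 + ‖y‖ ^ 2) ^ q
    have hinner : 2 * inner ℝ (A • x - B • y) (x - y) =
        (A + B) * ‖x - y‖ ^ 2 + (A - B) * (‖x‖ ^ 2 - ‖y‖ ^ 2) := by
      rw [norm_sub_sq_real, inner_sub_left, inner_sub_right, inner_sub_right]
      simp only [real_inner_smul_left, real_inner_self_eq_norm_sq, real_inner_comm x y]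
      ring
    have hcs := real_inner_le_norm (A • x - B • y) (x - y)
    rcases (norm_nonneg (x - y)).eq_or_lt with hd | hd
    · rw [← hd, mul_zero]
      positivity
    · refine le_of_mul_le_mul_right ?_ hd
      nlinarith [mul_nonneg (sub_nonneg.2 hBA) (sub_nonneg.2 hsq),
        mul_nonneg hB.le (sq_nonneg ‖x - y‖)]
  · set A := (1 + ‖x‖ ^ 2) ^ q
    set B := (1 + ‖y‖ ^ 2) ^ q
    have htri : ‖A • (x - y)‖ ≤ ‖A • x - B • y‖ + ‖(A - B) • y‖ := by
      rw [show A • (x - y) = (A • x - B • y) - (A - B) • y by module]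
      exact norm_sub_le _ _
    rw [norm_smul, norm_of_nonneg hA.le] at htri
    rw [abs_of_nonpos h0] at h
    nlinarith [mul_nonneg hA.le (norm_nonneg (x - y))]

end InnerProductSpace

theorem rpow_le_two_rpow_abs_mul_rpow {s t r : ℝ} (hs : 0 < s) (ht : 0 < t)
    (hst : s ≤ 2 * t) (hts : t ≤ 2 * s) : s ^ r ≤ 2 ^ |r| * t ^ r := by
  rcases le_total 0 r with h | h
  · rw [abs_of_nonneg h, ← mul_rpow zero_le_two ht.le]
    gcongr
  · rw [abs_of_nonpos h, rpow_neg zero_le_two, ← inv_rpow zero_le_two,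
      ← mul_rpow (by norm_num) ht.le]
    exact rpow_le_rpow_of_nonpos (by positivity) (by linarith) h

/-- The two-sided estimate for `V_p` with an explicit constant, for ordered norms. -/
theorem Vp_sub_div_bounds {n : ℕ} {p : ℝ} (hp : 1 ≤ p) {ξ η : EuclideanSpace ℝ (Fin n)}
    (hne : ξ ≠ η) (hle : ‖η‖ ≤ ‖ξ‖) :
    (4 * (1 + 2 * |(p - 2) / 4|) ^ 2 * 2 ^ |(p - 2) / 2|)⁻¹ *
        (1 + ‖ξ‖ ^ 2 + ‖η‖ ^ 2) ^ ((p - 2) / 2) ≤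
          ‖Vp n p ξ - Vp n p η‖ ^ 2 / ‖ξ - η‖ ^ 2 ∧
      ‖Vp n p ξ - Vp n p η‖ ^ 2 / ‖ξ - η‖ ^ 2 ≤
        4 * (1 + 2 * |(p - 2) / 4|) ^ 2 * 2 ^ |(p - 2) / 2| *
          (1 + ‖ξ‖ ^ 2 + ‖η‖ ^ 2) ^ ((p - 2) / 2) := by
  have hd : 0 < ‖ξ - η‖ := norm_pos_iff.2 (sub_ne_zero.2 hne)
  have hsq : ‖η‖ ^ 2 ≤ ‖ξ‖ ^ 2 := by gcongr
  have hup := norm_weight_smul_sub_le (q := (p - 2) / 4) (by linarith) hle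
  have hlow := weight_mul_norm_sub_le (q := (p - 2) / 4) (by linarith) hle
  have hA2 : ((1 + ‖ξ‖ ^ 2) ^ ((p - 2) / 4)) ^ 2 = (1 + ‖ξ‖ ^ 2) ^ ((p - 2) / 2) := by
    rw [← rpow_mul_natCast (by positivity)]
    congr 1
    push_cast
    ring
  have hMA := rpow_le_two_rpow_abs_mul_rpow (r := (p - 2) / 2)
    (s := 1 + ‖ξ‖ ^ 2 + ‖η‖ ^ 2) (t := 1 + ‖ξ‖ ^ 2) (by positivity) (by positivity)
    (by linarith) (by nlinarith [sq_nonneg ‖η‖])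
  have hAM := rpow_le_two_rpow_abs_mul_rpow (r := (p - 2) / 2)
    (s := 1 + ‖ξ‖ ^ 2) (t := 1 + ‖ξ‖ ^ 2 + ‖η‖ ^ 2) (by positivity) (by positivity)
    (by nlinarith [sq_nonneg ‖η‖]) (by linarith)
  rw [← hA2] at hMA hAM
  have hM : 0 < (1 + ‖ξ‖ ^ 2 + ‖η‖ ^ 2) ^ ((p - 2) / 2) := by positivity
  have hA : 0 < (1 + ‖ξ‖ ^ 2) ^ ((p - 2) / 4) := by positivity
  have hL : (0 : ℝ) < 2 ^ |(p - 2) / 2| := by positivity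
  have hK : 1 ≤ 1 + 2 * |(p - 2) / 4| := by linarith [abs_nonneg ((p - 2) / 4)]
  unfold Vp
  set M := (1 + ‖ξ‖ ^ 2 + ‖η‖ ^ 2) ^ ((p - 2) / 2)
  set A := (1 + ‖ξ‖ ^ 2) ^ ((p - 2) / 4)
  set v := ‖A • ξ - (1 + ‖η‖ ^ 2) ^ ((p - 2) / 4) • η‖
  set L : ℝ := 2 ^ |(p - 2) / 2|
  set K := 1 + 2 * |(p - 2) / 4|
  constructor
  · rw [inv_mul_le_iff₀ (by positivity), ← mul_div_assoc, le_div_iff₀ (by positivity)]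
    calc M * ‖ξ - η‖ ^ 2 ≤ L * A ^ 2 * ‖ξ - η‖ ^ 2 := by gcongr
      _ = L * (A * ‖ξ - η‖) ^ 2 := by ring
      _ ≤ L * (2 * v) ^ 2 := by gcongr
      _ = 4 * 1 ^ 2 * L * v ^ 2 := by ring
      _ ≤ 4 * K ^ 2 * L * v ^ 2 := by gcongr
  · rw [div_le_iff₀ (by positivity)]
    calc v ^ 2 ≤ (K * A * ‖ξ - η‖) ^ 2 := by gcongr
      _ = 1 * K ^ 2 * ‖ξ - η‖ ^ 2 * A ^ 2 := by ring
      _ ≤ 4 * K ^ 2 * ‖ξ - η‖ ^ 2 * (L * M) := by gcongr; norm_num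
      _ = 4 * K ^ 2 * L * M * ‖ξ - η‖ ^ 2 := by ring

/-- For `1 < p < ∞` there is `C = C(n,p) > 0` such that
`C⁻¹ (1+|ξ|²+|η|²)^((p−2)/2) ≤ |V_p(ξ)−V_p(η)|²/|ξ−η|² ≤ C (1+|ξ|²+|η|²)^((p−2)/2)`. -/
theorem stmt_0 (n : ℕ) (hn : 1 ≤ n) (p : ℝ) (hp : 1 < p) :
    ∃ C : ℝ, 0 < C ∧ ∀ ξ η : EuclideanSpace ℝ (Fin n), ξ ≠ η →
      C⁻¹ * (1 + ‖ξ‖ ^ 2 + ‖η‖ ^ 2) ^ ((p - 2) / 2) ≤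
          ‖Vp n p ξ - Vp n p η‖ ^ 2 / ‖ξ - η‖ ^ 2 ∧
        ‖Vp n p ξ - Vp n p η‖ ^ 2 / ‖ξ - η‖ ^ 2 ≤
          C * (1 + ‖ξ‖ ^ 2 + ‖η‖ ^ 2) ^ ((p - 2) / 2) := by
  refine ⟨4 * (1 + 2 * |(p - 2) / 4|) ^ 2 * 2 ^ |(p - 2) / 2|, by positivity,
    fun ξ η hne => ?_⟩
  rcases le_total ‖η‖ ‖ξ‖ with h | h
  · exact Vp_sub_div_bounds hp.le hne h
  · rw [norm_sub_rev (Vp n p ξ), norm_sub_rev ξ, add_right_comm]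
    exact Vp_sub_div_bounds hp.le hne.symm h
end

section
/- For every s, t > 0 and every α, ε, γ > 0 one has s·t ≤ ε·s·(log(e+γs))^α + (t/γ)·(exp((t/ε)^(1/α)) − 1). -/
open Real

/-- For every `s, t > 0` and every `α, ε, γ > 0` one has
`s·t ≤ ε·s·(log(e+γs))^α + (t/γ)·(exp((t/ε)^(1/α)) − 1)`. -/
theorem stmt_1 (s t α ε γ : ℝ) (hs : 0 < s) (ht : 0 < t)
    (hα : 0 < α) (hε : 0 < ε) (hγ : 0 < γ) :
    s * t ≤ ε * s * (Real.log (Real.exp 1 + γ * s)) ^ α +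
      (t / γ) * (Real.exp ((t / ε) ^ (1 / α)) - 1) := by
  have hL : 0 < Real.log (Real.exp 1 + γ * s) := by
    refine Real.log_pos ?_
    have := Real.add_one_le_exp (1 : ℝ)
    have : 0 < γ * s := by positivity
    linarith
  have hx : 0 ≤ (t / ε) ^ (1 / α) := by positivity
  rcases le_or_gt ((t / ε) ^ (1 / α)) (Real.log (Real.exp 1 + γ * s)) with h | h
  · have hpow : t / ε ≤ Real.log (Real.exp 1 + γ * s) ^ α := by
      rw [one_div] at h
      exact (Real.rpow_inv_le_iff_of_pos (by positivity) hL.le hα).1 h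
    have hfst : s * t ≤ ε * s * Real.log (Real.exp 1 + γ * s) ^ α := by
      calc s * t = ε * s * (t / ε) := by field_simp
        _ ≤ _ := by gcongr
    have hsnd : 0 ≤ t / γ * (Real.exp ((t / ε) ^ (1 / α)) - 1) :=
      mul_nonneg (by positivity) (sub_nonneg.2 (Real.one_le_exp hx))
    linarith
  · have hexp : γ * s ≤ Real.exp ((t / ε) ^ (1 / α)) - 1 := by
      have := (Real.log_lt_iff_lt_exp (by positivity)).1 h
      have := Real.add_one_le_exp (1 : ℝ)
      linarith
    have hsnd : s * t ≤ t / γ * (Real.exp ((t / ε) ^ (1 / α)) - 1) := by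
      calc s * t = t / γ * (γ * s) := by field_simp
        _ ≤ _ := by gcongr
    have hfst : 0 ≤ ε * s * Real.log (Real.exp 1 + γ * s) ^ α := by positivity
    linarith
end
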